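/- Let G be a finite, regular, connected, bipartite graph with bipartition V = A ∪ B, and let α = 1. Then almost surely the limit set of the sequence x(n) is contained in Ω = {(x_1,…,x_m) : ∃ p,q ≥ 0 with p+q = 2/m such that x_i = p for all i ∈ A and x_i = q for all i ∈ B}. -/

import Mathlib

open MeasureTheory Filter Topology

open MeasureTheory Filter Topology

/-- A generalized Pólya urn process with graph based interactions on a finite graph `G`
with vertex set `Fin m` and reinforcement exponent `α`, as in Benaïm–Benjamini–Chen–Lima.
`B n i` is the number of balls in bin `i` after step `n`; at each step, for each edge
`{i,j}` of `G` one ball is added to `i` or to `j`, with conditional probability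
`B_i(n)^α / (B_i(n)^α + B_j(n)^α)` for `i`, independently over distinct edges. -/
structure GraphUrn (m : ℕ) (G : SimpleGraph (Fin m)) [DecidableRel G.Adj] (α : ℝ) where
  /-- the underlying sample space -/
  Ω : Type
  /-- the ambient measurable structure -/
  [mΩ : MeasurableSpace Ω]
  /-- the underlying probability measure -/
  μ : Measure Ω
  isProb : IsProbabilityMeasure μ
  /-- `ℱ n` is the sigma-algebra generated by the process up to step `n` -/
  ℱ : Filtration ℕ mΩ
  /-- `B n i ω` is the number of balls in the bin at vertex `i` after step `n` -/
  B : ℕ → Fin m → Ω → ℕ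
  /-- `δ n i j ω = 1` iff at step `n` the ball of the edge `{i,j}` is added to bin `i` -/
  δ : ℕ → Fin m → Fin m → Ω → ℕ
  /-- each bin contains at least one ball initially -/
  B0_pos : ∀ i ω, 1 ≤ B 0 i ω
  /-- the initial configuration is deterministic -/
  B0_det : ∀ i ω ω', B 0 i ω = B 0 i ω'
  /-- on each edge, exactly one of the two endpoints receives the ball -/
  δ_sum : ∀ n i j, G.Adj i j → ∀ ω, δ n i j ω + δ n j i ω = 1
  /-- the evolution of the number of balls in each bin -/
  B_succ : ∀ n i ω, B (n + 1) i ω = B n i ω + ∑ j ∈ G.neighborFinset i, δ (n + 1) i j ω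
  /-- the number of balls after step `n` is measurable with respect to `ℱ n` -/
  B_adapted : ∀ n i, Measurable[ℱ n] (B n i)
  /-- the choices at step `n` are measurable with respect to `ℱ n` -/
  δ_adapted : ∀ n i j, Measurable[ℱ n] (δ n i j)
  /-- conditionally on the past, the ball of the edge `{i,j}` at step `n+1` goes to bin `i`
  with probability `B_i(n)^α / (B_i(n)^α + B_j(n)^α)` -/
  cond_law : ∀ n i j, G.Adj i j →
    μ[fun ω => (δ (n + 1) i j ω : ℝ) | ℱ n] =ᵐ[μ]
      fun ω => (B n i ω : ℝ) ^ α / ((B n i ω : ℝ) ^ α + (B n j ω : ℝ) ^ α)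
  /-- conditionally on the past, the choices on distinct edges are independent -/
  cond_indep : ∀ n (s : Finset (Fin m × Fin m)), (∀ p ∈ s, G.Adj p.1 p.2) →
    (∀ p ∈ s, ∀ q ∈ s, p ≠ q → (s(p.1, p.2) : Sym2 (Fin m)) ≠ s(q.1, q.2)) →
    μ[fun ω => ∏ p ∈ s, (δ (n + 1) p.1 p.2 ω : ℝ) | ℱ n] =ᵐ[μ]
      fun ω => ∏ p ∈ s, (μ[fun ω' => (δ (n + 1) p.1 p.2 ω' : ℝ) | ℱ n]) ω

namespace GraphUrn

variable {m : ℕ} {G : SimpleGraph (Fin m)} [DecidableRel G.Adj] {α : ℝ}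

/-- `x P n ω` is the vector of proportions of balls after step `n`:
`x_i(n) = B_i(n) / (N_0 + n N)` where `N_0` is the initial total number of balls and
`N` is the number of edges of `G`. -/
noncomputable def x (P : GraphUrn m G α) (n : ℕ) (ω : P.Ω) : Fin m → ℝ :=
  fun i => (P.B n i ω : ℝ) / (((∑ j, P.B 0 j ω) + n * G.edgeFinset.card : ℕ) : ℝ)

end GraphUrn


/-- discrete potential replacing the logarithm -/
noncomputable def urnPhi (r k : ℕ) : ℝ := ∑ l ∈ Finset.range k, 1 / ((max 1 (l + 1 - r) : ℕ) : ℝ)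

lemma urnPhi_step (r b d : ℕ) (hb : 1 ≤ b) (hd : d ≤ r) :
    (d : ℝ) / b ≤ urnPhi r (b + d) - urnPhi r b := by
  unfold urnPhi
  rw [Finset.sum_range_add, add_sub_cancel_left]
  have : ∀ l ∈ Finset.range d, (1 : ℝ) / b ≤ 1 / ((max 1 (b + l + 1 - r) : ℕ) : ℝ) := by
    intro l hl
    rw [Finset.mem_range] at hl
    apply one_div_le_one_div_of_le
    · exact_mod_cast (by positivity)
    · have : max 1 (b + l + 1 - r) ≤ b := by omega
      exact_mod_cast this
  have h := Finset.sum_le_sum this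
  simp only [Finset.sum_const, Finset.card_range, nsmul_eq_mul] at h
  calc (d : ℝ) / b = d * (1 / b) := by ring
    _ ≤ _ := h

lemma urnPhi_nonneg (r k : ℕ) : 0 ≤ urnPhi r k := Finset.sum_nonneg fun _ _ => by positivity

lemma urnPhi_mono (r : ℕ) : Monotone (urnPhi r) := by
  intro a b hab
  unfold urnPhi
  apply Finset.sum_le_sum_of_subset_of_nonneg
  · exact Finset.range_subset_range.2 hab
  · intros; positivity

lemma urnPhi_le (r k : ℕ) : urnPhi r k ≤ r + 1 + Real.log k := by
  have h1 : urnPhi r k ≤ urnPhi r (r + k) := urnPhi_mono r (by omega)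
  have h2 : urnPhi r (r + k) ≤ r + (harmonic k : ℝ) := by
    unfold urnPhi
    rw [Finset.sum_range_add]
    apply add_le_add
    · calc _ ≤ ∑ l ∈ Finset.range r, (1 : ℝ) := by
            apply Finset.sum_le_sum
            intro l _
            rw [div_le_one (by positivity)]
            exact_mod_cast le_max_left _ _
        _ = r := by simp
    · unfold harmonic
      push_cast
      apply Finset.sum_le_sum
      intro l _
      have : r + l + 1 - r = l + 1 := by omega
      rw [this]
      simp
  have h3 := harmonic_le_one_add_log k
  linarith

lemma urn_det_lemma (a D : ℕ → ℝ) (C : ℝ) (hC : 0 ≤ C) (ha : ∀ n, 0 ≤ a n) (hna : ¬ Summable a)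
    (ha2 : Summable fun n => a n ^ 2) (hD : ∀ n, 0 ≤ D n)
    (hL : ∀ n, |D (n + 1) - D n| ≤ C * a n) (hs : Summable fun n => a n * D n) :
    Tendsto D atTop (𝓝 0) := by
  have hb : ∀ n, |D (n + 1) ^ 2 - D n ^ 2| ≤ 2 * C * (a n * D n) + C ^ 2 * a n ^ 2 := by
    intro n
    have e : D (n + 1) ^ 2 - D n ^ 2 = (D (n + 1) - D n) * (D (n + 1) + D n) := by ring
    have h1 := hL n
    have h2 := abs_le.1 h1
    rw [e, abs_mul, abs_of_nonneg (add_nonneg (hD _) (hD n))]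
    calc _ ≤ (C * a n) * (D (n + 1) + D n) :=
          mul_le_mul_of_nonneg_right h1 (add_nonneg (hD _) (hD n))
      _ ≤ (C * a n) * ((D n + C * a n) + D n) := by
          apply mul_le_mul_of_nonneg_left _ (mul_nonneg hC (ha n))
          linarith
      _ = _ := by ring
  have hsum : Summable fun n => D (n + 1) ^ 2 - D n ^ 2 := by
    apply Summable.of_norm_bounded ((hs.mul_left (2 * C)).add (ha2.mul_left (C ^ 2)))
    intro n
    rw [Real.norm_eq_abs]
    exact hb n
  have ht := hsum.hasSum.tendsto_sum_nat
  set T := ∑' n, (D (n + 1) ^ 2 - D n ^ 2)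
  have ht2 : Tendsto (fun n => D n ^ 2) atTop (𝓝 (T + D 0 ^ 2)) := by
    have := ht.add_const (D 0 ^ 2)
    refine this.congr fun n => ?_
    rw [Finset.sum_range_sub (fun n => D n ^ 2)]
    ring
  have ht3 : Tendsto D atTop (𝓝 (Real.sqrt (T + D 0 ^ 2))) := by
    have := (Real.continuous_sqrt.tendsto _).comp ht2
    refine this.congr fun n => ?_
    simp [Real.sqrt_sq (hD n)]
  have hz : Real.sqrt (T + D 0 ^ 2) = 0 := by
    by_contra hne
    have hpos : 0 < Real.sqrt (T + D 0 ^ 2) := lt_of_le_of_ne (Real.sqrt_nonneg _) (Ne.symm hne)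
    set L := Real.sqrt (T + D 0 ^ 2)
    apply hna
    have hev : ∀ᶠ n in atTop, L / 2 < D n := ht3.eventually (lt_mem_nhds (by linarith))
    obtain ⟨k, hk⟩ := eventually_atTop.1 hev
    have : Summable fun n => a (n + k) := by
      have h1 : Summable fun n => (2 / L) * (a (n + k) * D (n + k)) :=
        ((summable_nat_add_iff k).2 hs).mul_left _
      refine Summable.of_nonneg_of_le (fun n => ha _) (fun n => ?_) h1
      have := (hk (n + k) (by omega)).le
      have h4 := mul_le_mul_of_nonneg_left this (ha (n + k))
      calc a (n + k) = (2 / L) * (a (n + k) * (L / 2)) := by field_simp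
        _ ≤ _ := mul_le_mul_of_nonneg_left h4 (by positivity)
    exact (summable_nat_add_iff k).1 this
  rwa [hz] at ht3

lemma urn_ae_summable {Ω : Type*} [MeasurableSpace Ω] (μ : Measure Ω) (T : ℕ → Ω → ℝ)
    (hT : ∀ n ω, 0 ≤ T n ω) (hi : ∀ n, Integrable (T n) μ) (K : ℝ)
    (hK : ∀ M, ∑ n ∈ Finset.range M, ∫ ω, T n ω ∂μ ≤ K) :
    ∀ᵐ ω ∂μ, Summable fun n => T n ω := by
  have hs : Summable fun n => ∫ ω, T n ω ∂μ :=
    summable_of_sum_range_le (fun n => integral_nonneg (hT n)) hK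
  have h1 : ∫⁻ ω, ∑' n, ENNReal.ofReal (T n ω) ∂μ ≠ ⊤ := by
    rw [lintegral_tsum (fun n => (hi n).aemeasurable.ennreal_ofReal)]
    have : ∀ n, ∫⁻ ω, ENNReal.ofReal (T n ω) ∂μ = ENNReal.ofReal (∫ ω, T n ω ∂μ) := fun n =>
      (ofReal_integral_eq_lintegral_ofReal (hi n) (Eventually.of_forall (hT n))).symm
    simp_rw [this]
    exact hs.tsum_ofReal_ne_top
  have h2 := ae_lt_top' (AEMeasurable.tsum fun n => (hi n).aemeasurable.ennreal_ofReal) h1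
  filter_upwards [h2] with ω hω
  have := ENNReal.summable_toReal hω.ne
  refine this.congr fun n => ?_
  rw [ENNReal.toReal_ofReal (hT n ω)]

lemma urn_sum_swap {m : ℕ} {G : SimpleGraph (Fin m)} [DecidableRel G.Adj]
    (f : Fin m → Fin m → ℝ) :
    ∑ i, ∑ j ∈ G.neighborFinset i, f i j = ∑ i, ∑ j ∈ G.neighborFinset i, f j i := by
  apply Finset.sum_comm'
  intro i j
  simp [G.adj_comm]

lemma urn_two_card {m r : ℕ} {G : SimpleGraph (Fin m)} [DecidableRel G.Adj]
    (hreg : G.IsRegularOfDegree r) : (2 : ℝ) * G.edgeFinset.card = m * r := by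
  have h := G.sum_degrees_eq_twice_card_edges
  simp only [hreg.degree_eq, Finset.sum_const, Finset.card_univ, Fintype.card_fin, smul_eq_mul] at h
  exact_mod_cast h.symm

lemma urn_pointwise {m r : ℕ} {G : SimpleGraph (Fin m)} [DecidableRel G.Adj]
    (hreg : G.IsRegularOfDegree r) (hm : 0 < m) (b : Fin m → ℝ) (S : ℝ)
    (hb : ∀ i, 0 < b i) (hS : 0 < S) (hsum : ∑ i, b i = S) :
    (m : ℝ) ^ 2 / 8 * (1 / S) *
        ∑ i, ∑ j ∈ G.neighborFinset i, ((b i + b j) / S - 2 / m) ^ 2 ≤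
      (∑ i, ∑ j ∈ G.neighborFinset i, 1 / (b i + b j)) - m * G.edgeFinset.card / S := by
  have hm' : (0 : ℝ) < m := by exact_mod_cast hm
  have hbS : ∀ i, b i ≤ S := fun i => by
    rw [← hsum]
    exact Finset.single_le_sum (f := b) (fun j _ => (hb j).le) (Finset.mem_univ i)
  have hterm : ∀ i j, 1 / S * (m - (m : ℝ) ^ 2 / 4 * ((b i + b j) / S)
      + (m : ℝ) ^ 2 / 8 * ((b i + b j) / S - 2 / m) ^ 2) ≤ 1 / (b i + b j) := by
    intro i j
    have h1 : 0 < (b i + b j) / S := div_pos (add_pos (hb i) (hb j)) hS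
    have h2 : (b i + b j) / S ≤ 2 := by
      rw [div_le_iff₀ hS]; linarith [hbS i, hbS j]
    have e : 1 / (b i + b j) = 1 / S * (1 / ((b i + b j) / S)) := by
      have := (add_pos (hb i) (hb j)).ne'
      field_simp
    rw [e]
    apply mul_le_mul_of_nonneg_left _ (by positivity)
    generalize (b i + b j) / S = s at *
    rw [le_div_iff₀ h1]
    have e2 : (m - (m : ℝ) ^ 2 / 4 * s + (m : ℝ) ^ 2 / 8 * (s - 2 / m) ^ 2) * s
        = 1 - (m : ℝ) ^ 2 / 8 * (s - 2 / m) ^ 2 * (2 - s) := by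
      field_simp
      ring
    rw [e2]
    have : 0 ≤ (m : ℝ) ^ 2 / 8 * (s - 2 / m) ^ 2 * (2 - s) :=
      mul_nonneg (by positivity) (by linarith)
    linarith
  have h3 : ∑ i, ∑ j ∈ G.neighborFinset i, (1 / S * (m - (m : ℝ) ^ 2 / 4 * ((b i + b j) / S)
      + (m : ℝ) ^ 2 / 8 * ((b i + b j) / S - 2 / m) ^ 2)) ≤
      ∑ i, ∑ j ∈ G.neighborFinset i, 1 / (b i + b j) :=
    Finset.sum_le_sum fun i _ => Finset.sum_le_sum fun j _ => hterm i j
  have hcard := urn_two_card hreg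
  have h4 : ∑ i, ∑ j ∈ G.neighborFinset i, ((b i + b j) / S) = 2 * r := by
    have e1 : ∑ i, ∑ j ∈ G.neighborFinset i, b i / S = r := by
      simp only [Finset.sum_const, SimpleGraph.card_neighborFinset_eq_degree, hreg.degree_eq,
        nsmul_eq_mul]
      rw [← Finset.mul_sum, ← Finset.sum_div, hsum, div_self hS.ne', mul_one]
    have e2 := urn_sum_swap (G := G) (fun i _ => b i / S)
    simp only [add_div, Finset.sum_add_distrib]
    rw [← e2, e1]; ring
  have h5 : ∑ i : Fin m, ∑ j ∈ G.neighborFinset i, (m : ℝ) = m * r * m := by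
    simp only [Finset.sum_const, SimpleGraph.card_neighborFinset_eq_degree, hreg.degree_eq,
      nsmul_eq_mul, Finset.card_univ, Fintype.card_fin]
    ring
  simp only [← Finset.mul_sum, Finset.sum_add_distrib, Finset.sum_sub_distrib] at h3
  rw [h4, h5] at h3
  have e : (m : ℝ) * G.edgeFinset.card / S = 1 / S * (m * r * m - m ^ 2 / 4 * (2 * r)) := by
    have : (G.edgeFinset.card : ℝ) = m * r / 2 := by linarith
    rw [this]; ring
  rw [e]
  linarith

namespace GraphUrn

variable {m r : ℕ} {G : SimpleGraph (Fin m)} [DecidableRel G.Adj]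

lemma delta_le {α : ℝ} (P : GraphUrn m G α) (n : ℕ) {i j : Fin m} (h : G.Adj i j) (ω : P.Ω) :
    P.δ n i j ω ≤ 1 := by
  have := P.δ_sum n i j h ω
  omega

lemma incr_le {α : ℝ} (P : GraphUrn m G α) (hreg : G.IsRegularOfDegree r) (n : ℕ) (i : Fin m)
    (ω : P.Ω) : ∑ j ∈ G.neighborFinset i, P.δ n i j ω ≤ r := by
  calc _ ≤ ∑ j ∈ G.neighborFinset i, 1 :=
        Finset.sum_le_sum fun j hj => P.delta_le n ((G.mem_neighborFinset i j).1 hj) ω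
    _ = r := by simp [hreg.degree_eq]

lemma B_pos {α : ℝ} (P : GraphUrn m G α) (n : ℕ) (i : Fin m) (ω : P.Ω) : 1 ≤ P.B n i ω := by
  induction n with
  | zero => exact P.B0_pos i ω
  | succ n ih => rw [P.B_succ]; omega

lemma sum_B {α : ℝ} (P : GraphUrn m G α) (n : ℕ) (ω : P.Ω) :
    ∑ i, (P.B n i ω : ℝ) = (∑ j, P.B 0 j ω : ℕ) + n * G.edgeFinset.card := by
  induction n with
  | zero => simp
  | succ n ih =>
    have h1 : ∑ i, ∑ j ∈ G.neighborFinset i, (P.δ (n + 1) i j ω : ℝ) = G.edgeFinset.card := by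
      have h2 := urn_sum_swap (G := G) (fun i j => (P.δ (n + 1) i j ω : ℝ))
      have h3 : ∑ i, ∑ j ∈ G.neighborFinset i,
          ((P.δ (n + 1) i j ω : ℝ) + P.δ (n + 1) j i ω) = 2 * G.edgeFinset.card := by
        have : ∀ i, ∑ j ∈ G.neighborFinset i,
            ((P.δ (n + 1) i j ω : ℝ) + P.δ (n + 1) j i ω) = G.degree i := by
          intro i
          rw [← G.card_neighborFinset_eq_degree, Finset.card_eq_sum_ones]
          push_cast
          apply Finset.sum_congr rfl
          intro j hj
          exact_mod_cast P.δ_sum (n + 1) i j ((G.mem_neighborFinset i j).1 hj) ω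
        rw [Finset.sum_congr rfl fun i _ => this i]
        exact_mod_cast G.sum_degrees_eq_twice_card_edges
      simp only [Finset.sum_add_distrib] at h3
      linarith
    simp only [P.B_succ, Nat.cast_add, Nat.cast_sum, Finset.sum_add_distrib]
    simp only [Nat.cast_sum] at ih
    rw [ih, h1]
    push_cast
    ring

lemma B_le {α : ℝ} (P : GraphUrn m G α) (n : ℕ) (i : Fin m) (ω : P.Ω) :
    (P.B n i ω : ℝ) ≤ (∑ j, P.B 0 j ω : ℕ) + n * G.edgeFinset.card := by
  rw [← P.sum_B n ω]
  exact Finset.single_le_sum (f := fun i => (P.B n i ω : ℝ)) (fun j _ => by positivity)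
    (Finset.mem_univ i)

/-- integral of the increment divided by the current content -/
lemma integral_delta_div (P : GraphUrn m G 1) (n : ℕ) {i j : Fin m} (h : G.Adj i j) :
    letI := P.mΩ
    Integrable (fun ω => (P.δ (n + 1) i j ω : ℝ) / P.B n i ω) P.μ ∧
    Integrable (fun ω => (1 : ℝ) / (P.B n i ω + P.B n j ω)) P.μ ∧
    ∫ ω, (P.δ (n + 1) i j ω : ℝ) / P.B n i ω ∂P.μ =
      ∫ ω, (1 : ℝ) / (P.B n i ω + P.B n j ω) ∂P.μ := by
  let _ := P.mΩ
  have := P.isProb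
  have hle := P.ℱ.le n
  have hBm : ∀ i, Measurable[P.ℱ n] (fun ω => (P.B n i ω : ℝ)) := fun i =>
    measurable_from_top.comp (P.B_adapted n i)
  have hδm : Measurable (fun ω => (P.δ (n + 1) i j ω : ℝ)) :=
    measurable_from_top.comp ((P.δ_adapted (n + 1) i j).mono (P.ℱ.le _) le_rfl)
  have hB1 : ∀ i ω, (1 : ℝ) ≤ P.B n i ω := fun i ω => by exact_mod_cast P.B_pos n i ω
  have hδ1 : ∀ ω, (P.δ (n + 1) i j ω : ℝ) ≤ 1 := fun ω => by
    exact_mod_cast P.delta_le (n + 1) h ω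
  have hδi : Integrable (fun ω => (P.δ (n + 1) i j ω : ℝ)) P.μ := by
    apply Integrable.of_bound hδm.aestronglyMeasurable 1
    filter_upwards with ω
    rw [Real.norm_of_nonneg (by positivity)]
    exact hδ1 ω
  have hinv : StronglyMeasurable[P.ℱ n] (fun ω => ((P.B n i ω : ℝ))⁻¹) :=
    (hBm i).inv.stronglyMeasurable
  have hprod : Integrable (fun ω => (P.δ (n + 1) i j ω : ℝ) / P.B n i ω) P.μ := by
    apply Integrable.of_bound (hδm.div ((hBm i).mono hle le_rfl)).aestronglyMeasurable 1
    filter_upwards with ω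
    change ‖(P.δ (n + 1) i j ω : ℝ) / P.B n i ω‖ ≤ 1
    rw [Real.norm_of_nonneg (by positivity), div_le_one (by linarith [hB1 i ω])]
    exact (hδ1 ω).trans (hB1 i ω)
  refine ⟨hprod, ?_, ?_⟩
  · apply Integrable.of_bound (((measurable_const.div
      ((hBm i).add (hBm j))).mono hle le_rfl)).aestronglyMeasurable 1
    filter_upwards with ω
    change ‖(1 : ℝ) / (P.B n i ω + P.B n j ω)‖ ≤ 1
    rw [Real.norm_of_nonneg (by positivity), div_le_one (by linarith [hB1 i ω, hB1 j ω])]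
    linarith [hB1 i ω, hB1 j ω]
  · rw [← integral_condExp hle]
    apply integral_congr_ae
    have e : (fun ω => (P.δ (n + 1) i j ω : ℝ) / P.B n i ω) =
        (fun ω => ((P.B n i ω : ℝ))⁻¹) * (fun ω => (P.δ (n + 1) i j ω : ℝ)) := by
      funext ω
      simp only [Pi.mul_apply]
      ring
    have hp2 := hprod
    rw [e] at hp2 ⊢
    filter_upwards [condExp_mul_of_stronglyMeasurable_left hinv hp2 hδi, P.cond_law n i j h]
      with ω h1 h2
    rw [h1, Pi.mul_apply, h2]
    simp only [Real.rpow_one]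
    have := hB1 i ω
    have := hB1 j ω
    field_simp

end GraphUrn

namespace GraphUrn

variable {m r : ℕ} {G : SimpleGraph (Fin m)} [DecidableRel G.Adj]

lemma ae_summable (P : GraphUrn m G 1) (hreg : G.IsRegularOfDegree r) (hm : 0 < m) :
    ∀ᵐ ω ∂P.μ, Summable fun n : ℕ =>
      (∑ i, ∑ j ∈ G.neighborFinset i, (1 : ℝ) / (P.B n i ω + P.B n j ω)) -
        m * G.edgeFinset.card / ((∑ j, P.B 0 j ω : ℕ) + n * G.edgeFinset.card : ℝ) := by
  let _ := P.mΩ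
  have := P.isProb
  obtain ⟨ω₀⟩ : Nonempty P.Ω := P.μ.nonempty_of_neZero
  obtain ⟨N0, hN0⟩ : ∃ N0 : ℕ, ∀ ω, ∑ j, P.B 0 j ω = N0 :=
    ⟨∑ j, P.B 0 j ω₀, fun ω => Finset.sum_congr rfl fun j _ => P.B0_det j ω ω₀⟩
  have hN0pos : (0 : ℝ) < N0 := by
    rw [← hN0 ω₀]
    have h1 := Finset.single_le_sum (f := fun j => P.B 0 j ω₀) (fun _ _ => Nat.zero_le _)
      (Finset.mem_univ (⟨0, hm⟩ : Fin m))
    have h2 := P.B0_pos ⟨0, hm⟩ ω₀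
    have : 0 < ∑ j, P.B 0 j ω₀ := by omega
    exact_mod_cast this
  set N := G.edgeFinset.card with hN
  simp only [hN0]
  set S : ℕ → ℝ := fun n => (N0 : ℝ) + n * N with hSdef
  have hSpos : ∀ n, 0 < S n := fun n => by positivity
  have hsumB : ∀ n ω, ∑ i, (P.B n i ω : ℝ) = S n := fun n ω => by
    rw [P.sum_B n ω, hN0 ω]
  have hBS : ∀ n i ω, (P.B n i ω : ℝ) ≤ S n := fun n i ω => by
    have := P.B_le n i ω
    rwa [hN0 ω] at this
  have hB1 : ∀ n i ω, (1 : ℝ) ≤ P.B n i ω := fun n i ω => by exact_mod_cast P.B_pos n i ω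
  have hBm : ∀ n i, Measurable (P.B n i) := fun n i => (P.B_adapted n i).mono (P.ℱ.le n) le_rfl
  -- the potential
  set Φ : ℕ → P.Ω → ℝ := fun n ω => ∑ i, urnPhi r (P.B n i ω) with hΦ
  have hphi : ∀ n i ω, urnPhi r (P.B n i ω) ≤ r + 1 + Real.log (S n) := fun n i ω =>
    (urnPhi_le r _).trans (by
      have := Real.log_le_log (by linarith [hB1 n i ω]) (hBS n i ω)
      linarith)
  have hphi_int : ∀ n i, Integrable (fun ω => urnPhi r (P.B n i ω)) P.μ := fun n i => by
    have hmeas : Measurable (fun ω => urnPhi r (P.B n i ω)) :=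
      (measurable_from_top (f := urnPhi r)).comp (hBm n i)
    apply Integrable.of_bound hmeas.aestronglyMeasurable (r + 1 + Real.log (S n))
    filter_upwards with ω
    rw [Real.norm_of_nonneg (urnPhi_nonneg _ _)]
    exact hphi n i ω
  have hΦint : ∀ n, Integrable (Φ n) P.μ := fun n => integrable_finsetSum _ fun i _ => hphi_int n i
  have hΦle : ∀ n, ∫ ω, Φ n ω ∂P.μ ≤ m * (r + 1 + Real.log (S n)) := fun n => by
    calc ∫ ω, Φ n ω ∂P.μ ≤ ∫ ω, (m * (r + 1 + Real.log (S n)) : ℝ) ∂P.μ := by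
          apply integral_mono (hΦint n) (integrable_const _)
          intro ω
          calc Φ n ω ≤ ∑ i : Fin m, (r + 1 + Real.log (S n)) :=
                Finset.sum_le_sum fun i _ => hphi n i ω
            _ = _ := by
                simp only [Finset.sum_const, Finset.card_univ, Fintype.card_fin, nsmul_eq_mul]
      _ = _ := by simp
  have hΦ0 : 0 ≤ ∫ ω, Φ 0 ω ∂P.μ :=
    integral_nonneg fun ω => Finset.sum_nonneg fun i _ => urnPhi_nonneg _ _
  -- the drift
  set R : ℕ → P.Ω → ℝ := fun n ω =>
    ∑ i, ∑ j ∈ G.neighborFinset i, (1 : ℝ) / (P.B n i ω + P.B n j ω) with hR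
  have hRint : ∀ n, Integrable (R n) P.μ := fun n =>
    integrable_finsetSum _ fun i _ => integrable_finsetSum _ fun j hj =>
      (P.integral_delta_div n ((G.mem_neighborFinset i j).1 hj)).2.1
  have hstep : ∀ n, ∫ ω, R n ω ∂P.μ ≤ ∫ ω, Φ (n + 1) ω ∂P.μ - ∫ ω, Φ n ω ∂P.μ := by
    intro n
    have hQint : ∀ i, ∀ j ∈ G.neighborFinset i,
        Integrable (fun ω => (P.δ (n + 1) i j ω : ℝ) / P.B n i ω) P.μ := fun i j hj =>
      (P.integral_delta_div n ((G.mem_neighborFinset i j).1 hj)).1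
    have e1 : ∫ ω, R n ω ∂P.μ =
        ∫ ω, ∑ i, ∑ j ∈ G.neighborFinset i, (P.δ (n + 1) i j ω : ℝ) / P.B n i ω ∂P.μ := by
      rw [hR]
      rw [integral_finsetSum _ fun i _ => integrable_finsetSum _ (hQint i)]
      rw [integral_finsetSum _ fun i _ => integrable_finsetSum _ fun j hj =>
        (P.integral_delta_div n ((G.mem_neighborFinset i j).1 hj)).2.1]
      apply Finset.sum_congr rfl
      intro i _
      rw [integral_finsetSum _ (hQint i)]
      rw [integral_finsetSum _ fun j hj =>
        (P.integral_delta_div n ((G.mem_neighborFinset i j).1 hj)).2.1]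
      apply Finset.sum_congr rfl
      intro j hj
      exact (P.integral_delta_div n ((G.mem_neighborFinset i j).1 hj)).2.2.symm
    rw [e1, ← integral_sub (hΦint _) (hΦint _)]
    apply integral_mono (integrable_finsetSum _ fun i _ => integrable_finsetSum _ (hQint i))
      ((hΦint _).sub (hΦint _))
    intro ω
    change ∑ i, ∑ j ∈ G.neighborFinset i, (P.δ (n + 1) i j ω : ℝ) / P.B n i ω ≤
      ∑ i, urnPhi r (P.B (n + 1) i ω) - ∑ i, urnPhi r (P.B n i ω)
    rw [← Finset.sum_sub_distrib]
    apply Finset.sum_le_sum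
    intro i _
    rw [P.B_succ, ← Finset.sum_div]
    have := urnPhi_step r (P.B n i ω) _ (P.B_pos n i ω) (P.incr_le hreg (n + 1) i ω)
    push_cast at this
    exact this
  refine urn_ae_summable P.μ (fun n ω => R n ω - m * N / S n) ?_ ?_
    (m * (r + 1) + m * Real.log (S 0)) ?_
  · intro n ω
    have h := urn_pointwise hreg hm (fun i => (P.B n i ω : ℝ)) (S n)
      (fun i => by linarith [hB1 n i ω]) (hSpos n) (hsumB n ω)
    refine le_trans ?_ h
    have := hSpos n
    exact mul_nonneg (by positivity) (Finset.sum_nonneg fun i _ => Finset.sum_nonneg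
      fun j _ => sq_nonneg _)
  · intro n
    exact (hRint n).sub (integrable_const _)
  · intro M
    have hlog : ∀ n, Real.log (S (n + 1)) - Real.log (S n) ≤ N / S n := by
      intro n
      rw [← Real.log_div (hSpos _).ne' (hSpos n).ne']
      have h1 := Real.log_le_sub_one_of_pos (div_pos (hSpos (n + 1)) (hSpos n))
      have h2 : S (n + 1) / S n - 1 = N / S n := by
        have := (hSpos n).ne'
        field_simp
        simp only [hSdef]
        push_cast
        ring
      linarith
    have h1 : ∑ n ∈ Finset.range M, ∫ ω, (R n ω - m * N / S n) ∂P.μ ≤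
        ∑ n ∈ Finset.range M, ((∫ ω, Φ (n + 1) ω ∂P.μ - m * Real.log (S (n + 1)))
          - (∫ ω, Φ n ω ∂P.μ - m * Real.log (S n))) := by
      apply Finset.sum_le_sum
      intro n _
      rw [integral_sub (hRint n) (integrable_const _)]
      have h2 := mul_le_mul_of_nonneg_left (hlog n) (Nat.cast_nonneg (α := ℝ) m)
      have h3 := hstep n
      have h4 : (m : ℝ) * (N / S n) = m * N / S n := by ring
      simp only [integral_const, probReal_univ, one_smul]
      linarith
    rw [Finset.sum_range_sub (fun n => ∫ ω, Φ n ω ∂P.μ - m * Real.log (S n))] at h1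
    have h2 := hΦle M
    linarith

lemma ae_tendsto (P : GraphUrn m G 1) (hreg : G.IsRegularOfDegree r) (hm : 0 < m) (hr : 0 < r) :
    ∀ᵐ ω ∂P.μ, ∀ i j, G.Adj i j →
      Tendsto (fun n => (P.x n ω i + P.x n ω j - 2 / m) ^ 2) atTop (𝓝 0) := by
  filter_upwards [P.ae_summable hreg hm] with ω hω i j hij
  have hm' : (1 : ℝ) ≤ m := by exact_mod_cast hm
  set N := G.edgeFinset.card with hN
  have hNpos : (1 : ℝ) ≤ N := by
    have h := urn_two_card hreg
    rw [← hN] at h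
    have : 0 < N := by
      rcases Nat.eq_zero_or_pos N with h0 | h0
      · rw [h0] at h
        have : (0 : ℝ) < m * r := by positivity
        simp at h
        rcases h with h | h <;> omega
      · exact h0
    exact_mod_cast this
  have hN0pos : (1 : ℝ) ≤ (∑ j, P.B 0 j ω : ℕ) := by
    have h1 := Finset.single_le_sum (f := fun j => P.B 0 j ω) (fun _ _ => Nat.zero_le _)
      (Finset.mem_univ (⟨0, hm⟩ : Fin m))
    have h2 := P.B0_pos ⟨0, hm⟩ ω
    have : 1 ≤ ∑ j, P.B 0 j ω := by omega
    exact_mod_cast this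
  have hsumB := fun n => P.sum_B n ω
  have hBS := fun n i => P.B_le n i ω
  have hxdef : ∀ n i, P.x n ω i = (P.B n i ω : ℝ) / ((∑ j, P.B 0 j ω : ℕ) + n * N) := by
    intro n i
    unfold GraphUrn.x
    push_cast
    rfl
  rw [← hN] at hsumB hBS
  generalize ∑ j, P.B 0 j ω = N0 at *
  set S : ℕ → ℝ := fun n => (N0 : ℝ) + n * N with hSdef
  have hSge : ∀ n : ℕ, (n : ℝ) + 1 ≤ S n := fun n => by
    have : (n : ℝ) * 1 ≤ n * N := mul_le_mul_of_nonneg_left hNpos (Nat.cast_nonneg n)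
    simp only [hSdef]; linarith
  have hSpos : ∀ n, 0 < S n := fun n => lt_of_lt_of_le (by positivity) (hSge n)
  have hB1 : ∀ n i, (1 : ℝ) ≤ P.B n i ω := fun n i => by exact_mod_cast P.B_pos n i ω
  have hx0 : ∀ n i, 0 ≤ P.x n ω i := fun n i => by
    rw [hxdef]; exact div_nonneg (by positivity) (hSpos n).le
  have hx1 : ∀ n i, P.x n ω i ≤ 1 := fun n i => by
    rw [hxdef, div_le_one (hSpos n)]; exact hBS n i
  have hxL : ∀ n i, |P.x (n + 1) ω i - P.x n ω i| ≤ (r + N) * (1 / S n) := by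
    intro n i
    have hd : ((∑ j ∈ G.neighborFinset i, P.δ (n + 1) i j ω : ℕ) : ℝ) ≤ r := by
      exact_mod_cast P.incr_le hreg (n + 1) i ω
    have hS1 : S (n + 1) = S n + N := by simp only [hSdef]; push_cast; ring
    have e : P.x (n + 1) ω i - P.x n ω i =
        ((∑ j ∈ G.neighborFinset i, P.δ (n + 1) i j ω : ℕ) - P.x n ω i * N) / (S n + N) := by
      have h0 := hxdef (n + 1) i
      have h1 : P.x n ω i = P.B n i ω / S n := hxdef n i
      change _ = _ / S (n + 1) at h0
      rw [h0, h1, P.B_succ, hS1, Nat.cast_add]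
      have := hSpos n
      have : S n + N ≠ 0 := by positivity
      field_simp
      ring
    rw [e, abs_div, abs_of_pos (by linarith [hSpos n] : 0 < S n + N), mul_one_div]
    have hd0 : (0 : ℝ) ≤ ((∑ j ∈ G.neighborFinset i, P.δ (n + 1) i j ω : ℕ) : ℝ) :=
      Nat.cast_nonneg _
    have hxN0 : 0 ≤ P.x n ω i * N := mul_nonneg (hx0 n i) (by linarith)
    have hxN1 : P.x n ω i * N ≤ 1 * N := mul_le_mul_of_nonneg_right (hx1 n i) (by linarith)
    have hr0 : (0 : ℝ) ≤ r := Nat.cast_nonneg _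
    apply div_le_div₀ (by positivity) _ (hSpos n) (by linarith)
    rw [abs_le]
    constructor <;> linarith
  apply urn_det_lemma (fun n => 1 / S n) _ (16 * (r + N)) (by positivity)
    (fun n => by have := hSpos n; positivity)
  · intro hs
    have h1 : Summable fun n : ℕ => (N0 + N : ℝ) * (1 / S n) := hs.mul_left _
    have h2 : Summable fun n : ℕ => 1 / ((n + 1 : ℕ) : ℝ) := by
      refine Summable.of_nonneg_of_le (fun n => by positivity) (fun n => ?_) h1
      rw [mul_one_div, div_le_div_iff₀ (by positivity) (hSpos n)]
      simp only [hSdef]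
      push_cast
      have : (0 : ℝ) ≤ n * N0 := by positivity
      nlinarith
    exact Real.not_summable_one_div_natCast
      ((summable_nat_add_iff (f := fun n : ℕ => 1 / (n : ℝ)) 1).1 h2)
  · have h2 : Summable fun n : ℕ => 1 / ((n + 1 : ℕ) : ℝ) ^ 2 :=
      (summable_nat_add_iff (f := fun n : ℕ => 1 / (n : ℝ) ^ 2) 1).2
        (Real.summable_one_div_nat_pow.2 (by norm_num))
    refine Summable.of_nonneg_of_le (fun n => by positivity) (fun n => ?_) h2
    rw [div_pow, one_pow]
    apply one_div_le_one_div_of_le (by positivity)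
    apply pow_le_pow_left₀ (by positivity)
    push_cast
    exact hSge n
  · intro n; positivity
  · intro n
    have hm2 : (2 : ℝ) / m ≤ 2 := by
      rw [div_le_iff₀ (by linarith)]; linarith
    have hm0 : (0 : ℝ) ≤ 2 / m := by positivity
    have e : (P.x (n + 1) ω i + P.x (n + 1) ω j - 2 / m) ^ 2 -
        (P.x n ω i + P.x n ω j - 2 / m) ^ 2 =
        ((P.x (n + 1) ω i - P.x n ω i) + (P.x (n + 1) ω j - P.x n ω j)) *
        ((P.x (n + 1) ω i + P.x (n + 1) ω j - 2 / m) + (P.x n ω i + P.x n ω j - 2 / m)) := by ring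
    rw [e, abs_mul]
    have h1 : |(P.x (n + 1) ω i - P.x n ω i) + (P.x (n + 1) ω j - P.x n ω j)| ≤
        2 * ((r + N) * (1 / S n)) := by
      refine (abs_add_le _ _).trans ?_
      linarith [hxL n i, hxL n j]
    have h2 : |(P.x (n + 1) ω i + P.x (n + 1) ω j - 2 / m) +
        (P.x n ω i + P.x n ω j - 2 / m)| ≤ 8 := by
      rw [abs_le]
      constructor <;> linarith [hx0 n i, hx0 n j, hx1 n i, hx1 n j, hx0 (n + 1) i,
        hx0 (n + 1) j, hx1 (n + 1) i, hx1 (n + 1) j]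
    have h3 := hSpos n
    calc _ ≤ (2 * ((r + N) * (1 / S n))) * 8 :=
          mul_le_mul h1 h2 (abs_nonneg _) (by positivity)
      _ = _ := by ring
  · refine Summable.of_nonneg_of_le (fun n => ?_) (fun n => ?_) (hω.mul_left (8 / (m : ℝ) ^ 2))
    · have := hSpos n; positivity
    · have h := urn_pointwise hreg hm (fun i => (P.B n i ω : ℝ)) (S n)
        (fun i => by linarith [hB1 n i]) (hSpos n) (hsumB n)
      have h' := mul_le_mul_of_nonneg_left h (by positivity : (0 : ℝ) ≤ 8 / (m : ℝ) ^ 2)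
      refine le_trans ?_ h'
      have h1 : (P.x n ω i + P.x n ω j - 2 / m) ^ 2 ≤ ∑ i, ∑ j ∈ G.neighborFinset i,
          (((P.B n i ω : ℝ) + P.B n j ω) / S n - 2 / m) ^ 2 := by
        have e : (P.x n ω i + P.x n ω j - 2 / m) ^ 2 =
            (((P.B n i ω : ℝ) + P.B n j ω) / S n - 2 / m) ^ 2 := by
          rw [hxdef, hxdef, ← add_div]
        rw [e]
        refine le_trans ?_ (Finset.single_le_sum (f := fun i => ∑ j ∈ G.neighborFinset i,
          (((P.B n i ω : ℝ) + P.B n j ω) / S n - 2 / m) ^ 2)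
          (fun i _ => Finset.sum_nonneg fun j _ => sq_nonneg _) (Finset.mem_univ i))
        exact Finset.single_le_sum (f := fun j =>
          (((P.B n i ω : ℝ) + P.B n j ω) / S n - 2 / m) ^ 2)
          (fun j _ => sq_nonneg _) ((G.mem_neighborFinset i j).2 hij)
      have h2 := mul_le_mul_of_nonneg_left h1 (by have := hSpos n; positivity : 0 ≤ 1 / S n)
      refine h2.trans (le_of_eq ?_)
      generalize ∑ i, ∑ j ∈ G.neighborFinset i,
        (((P.B n i ω : ℝ) + P.B n j ω) / S n - 2 / m) ^ 2 = Z
      field_simp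

end GraphUrn

/-- **Theorem 1(b).** For a finite, regular, connected, bipartite graph `G` with bipartition
`V = A ∪ Aᶜ` and `α = 1`, almost surely every cluster point of the sequence `x(n)` lies in
`Ω = {x : ∃ p q ≥ 0, p + q = 2/m, x ≡ p on A and x ≡ q on Aᶜ}`. -/
theorem polya_urn_regular_bipartite_limit_set
    {m r : ℕ} {G : SimpleGraph (Fin m)} [DecidableRel G.Adj]
    (hreg : G.IsRegularOfDegree r) (hconn : G.Connected)
    (A : Finset (Fin m)) (hA : ∀ i j, G.Adj i j → (i ∈ A ↔ j ∉ A))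
    (P : GraphUrn m G 1) :
    ∀ᵐ ω ∂P.μ, ∀ v : Fin m → ℝ, MapClusterPt v atTop (fun n => P.x n ω) →
      ∃ p q : ℝ, 0 ≤ p ∧ 0 ≤ q ∧ p + q = 2 / (m : ℝ) ∧
        (∀ i, i ∈ A → v i = p) ∧ (∀ i, i ∉ A → v i = q) := by
  have hne : Nonempty (Fin m) := hconn.nonempty
  obtain ⟨i₀⟩ := hne
  have hm : 0 < m := i₀.pos
  rcases Nat.eq_zero_or_pos r with hr | hr
  · -- no edges: a single vertex
    subst hr
    have hnadj : ∀ i j, ¬ G.Adj i j := by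
      intro i j hij
      have h1 := hreg.degree_eq i
      have h2 := (G.degree_pos_iff_exists_adj i).2 ⟨j, hij⟩
      omega
    have hall : ∀ i, i = i₀ := by
      intro i
      obtain ⟨w⟩ := hconn.preconnected i i₀
      cases w with
      | nil => rfl
      | cons h _ => exact absurd h (hnadj _ _)
    have hm1 : m = 1 := by
      have : Fintype.card (Fin m) = 1 := Fintype.card_eq_one_iff.2 ⟨i₀, hall⟩
      simpa using this
    refine Eventually.of_forall fun ω v hv => ?_
    have hx : ∀ n, P.x n ω i₀ = 1 := by
      intro n
      have h1 := P.sum_B n ω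
      have h3 : P.x n ω i₀ = (P.B n i₀ ω : ℝ) / ((∑ j, P.B 0 j ω : ℕ) + n * G.edgeFinset.card) := by
        unfold GraphUrn.x
        push_cast
        rfl
      have h4 : ∑ i, (P.B n i ω : ℝ) = P.B n i₀ ω :=
        Fintype.sum_eq_single i₀ fun i hi => absurd (hall i) hi
      rw [h3, ← h1, h4]
      have h5 : (1 : ℝ) ≤ P.B n i₀ ω := by exact_mod_cast P.B_pos n i₀ ω
      exact div_self (by linarith)
    have hv1 : v i₀ = 1 := by
      have h1 : MapClusterPt (v i₀) atTop (fun n => P.x n ω i₀) :=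
        hv.continuousAt_comp (f := fun y : Fin m → ℝ => y i₀) (continuous_apply i₀).continuousAt
      have h2 : Tendsto (fun n => P.x n ω i₀) atTop (𝓝 1) := by
        simp only [hx]
        exact tendsto_const_nhds
      exact eq_of_nhds_neBot (h1.clusterPt.mono h2)
    refine ⟨1, 1, zero_le_one, zero_le_one, ?_, ?_, ?_⟩
    · rw [hm1]; norm_num
    · intro i _; rw [hall i, hv1]
    · intro i _; rw [hall i, hv1]
  filter_upwards [P.ae_tendsto hreg hm hr] with ω hω v hv
  have hv0 : ∀ i, 0 ≤ v i := by
    intro i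
    have hcl : IsClosed {y : Fin m → ℝ | 0 ≤ y i} :=
      isClosed_le continuous_const (continuous_apply i)
    refine hcl.mem_of_mapClusterPt hv (Eventually.of_forall fun n => ?_)
    change 0 ≤ (P.B n i ω : ℝ) / _
    positivity
  have hedge : ∀ i j, G.Adj i j → v i + v j = 2 / m := by
    intro i j hij
    have h1 : MapClusterPt ((v i + v j - 2 / m) ^ 2) atTop
        (fun n => (P.x n ω i + P.x n ω j - 2 / m) ^ 2) :=
      hv.continuousAt_comp (f := fun y : Fin m → ℝ => (y i + y j - 2 / (m : ℝ)) ^ 2)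
        (by fun_prop)
    have h2 : (v i + v j - 2 / m) ^ 2 = 0 := eq_of_nhds_neBot (h1.clusterPt.mono (hω i j hij))
    have h3 := pow_eq_zero_iff (two_ne_zero) |>.1 h2
    linarith
  set c : Fin m → ℝ := fun i => if i ∈ A then v i else 2 / m - v i with hc
  have hcadj : ∀ i j, G.Adj i j → c i = c j := by
    intro i j hij
    have h1 := hA i j hij
    have h2 := hedge i j hij
    by_cases hi : i ∈ A
    · have hj := h1.1 hi
      simp only [hc, if_pos hi, if_neg hj]; linarith
    · have hj : j ∈ A := by
        by_contra hj
        exact hi (h1.2 hj)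
      simp only [hc, if_neg hi, if_pos hj]; linarith
  have hcc : ∀ i, c i = c i₀ := by
    intro i
    obtain ⟨w⟩ := hconn.preconnected i i₀
    induction w with
    | nil => rfl
    | cons h _ ih => exact (hcadj _ _ h).trans ih
  obtain ⟨j₀, hj₀⟩ : ∃ j, G.Adj i₀ j := by
    rw [← G.degree_pos_iff_exists_adj, hreg.degree_eq]; exact hr
  have h00 := hedge _ _ hj₀
  have hi0 := hv0 i₀
  have hj0 := hv0 j₀
  refine ⟨c i₀, 2 / m - c i₀, ?_, ?_, by ring, ?_, ?_⟩
  · simp only [hc]; split_ifs <;> linarith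
  · simp only [hc]; split_ifs <;> linarith
  · intro i hi
    rw [← hcc i]; simp only [hc, if_pos hi]
  · intro i hi
    rw [← hcc i]; simp only [hc, if_neg hi]; ring
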